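/- The torsion function dominates the first eigenfunction: Let Ω ⊆ ℝ^n (n ≥ 2) be a nonempty bounded open set, let u be a normalized first eigenfunction of Ω, and suppose u ≤ M almost everywhere for some M > 0. Then u ≤ λ₁(Ω)·M·w_Ω almost everywhere, where w_Ω is the torsion function of Ω. -/

import Mathlib

open MeasureTheory Metric Set Filter Bornology
open scoped ENNReal NNReal Topology

noncomputable section

abbrev Euc (n : ℕ) := EuclideanSpace ℝ (Fin n)

/-- A smooth test function compactly supported in `Ω`. -/
def IsTestFun {n : ℕ} (Ω : Set (Euc n)) (φ : Euc n → ℝ) : Prop :=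
  ContDiff ℝ (⊤ : ℕ∞) φ ∧ HasCompactSupport φ ∧ tsupport φ ⊆ Ω

/-- `u` belongs to `H¹₀(Ω)` with weak gradient `Du`: it is an `L²` limit of smooth
functions compactly supported in `Ω` whose gradients converge to `Du` in `L²`. -/
def MemH10 {n : ℕ} (Ω : Set (Euc n)) (u : Euc n → ℝ) (Du : Euc n → Euc n) : Prop :=
  MemLp u 2 volume ∧ MemLp Du 2 volume ∧
  ∃ φ : ℕ → Euc n → ℝ, (∀ k, IsTestFun Ω (φ k)) ∧
    Tendsto (fun k => ∫ x, (φ k x - u x) ^ 2) atTop (𝓝 0) ∧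
    Tendsto (fun k => ∫ x, ‖gradient (φ k) x - Du x‖ ^ 2) atTop (𝓝 0)

/-- First Dirichlet eigenvalue: infimum of the Rayleigh quotient over `H¹₀(Ω)`. -/
def lam1 {n : ℕ} (Ω : Set (Euc n)) : ℝ :=
  sInf {r | ∃ u Du, MemH10 Ω u Du ∧ (∫ x, u x ^ 2) ≠ 0 ∧
    r = (∫ x, ‖Du x‖ ^ 2) / (∫ x, u x ^ 2)}

/-- Torsional rigidity: `tor Ω = inf { ∫ (½|∇w|² − w) : w ∈ H¹₀(Ω) }`. -/
def tor {n : ℕ} (Ω : Set (Euc n)) : ℝ :=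
  sInf {r | ∃ w Dw, MemH10 Ω w Dw ∧ r = ∫ x, ((1 / 2) * ‖Dw x‖ ^ 2 - w x)}

/-- Normalized first eigenfunction of `Ω`, extended by zero outside `Ω`. -/
def IsEigenfun {n : ℕ} (Ω : Set (Euc n)) (u : Euc n → ℝ) : Prop :=
  (∀ᵐ x ∂volume, 0 ≤ u x) ∧ (∀ x ∉ Ω, u x = 0) ∧ (∫ x, u x ^ 2) = 1 ∧
  ∃ Du, MemH10 Ω u Du ∧ (∫ x, ‖Du x‖ ^ 2) = lam1 Ω

/-- The torsion function of `Ω` (the minimizer of the torsion energy),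
extended by zero outside `Ω`. -/
def IsTorsionFun {n : ℕ} (Ω : Set (Euc n)) (w : Euc n → ℝ) : Prop :=
  (∀ x ∉ Ω, w x = 0) ∧
  ∃ Dw, MemH10 Ω w Dw ∧ (∫ x, ((1 / 2) * ‖Dw x‖ ^ 2 - w x)) = tor Ω


lemma aux_intsq {n : ℕ} {F : Type*} [NormedAddCommGroup F] {f : Euc n → F} (hf : MemLp f 2 volume) :
    ∫ x, ‖f x‖ ^ 2 = (eLpNorm f 2 volume).toReal ^ 2 := by
  have h := hf.eLpNorm_eq_integral_rpow_norm (by norm_num) (by norm_num)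
  have h0 : 0 ≤ ∫ x, ‖f x‖ ^ 2 := integral_nonneg fun x => by positivity
  simp only [ENNReal.toReal_ofNat, Real.rpow_ofNat] at h
  rw [h, ENNReal.toReal_ofReal (by positivity), ← Real.rpow_natCast, ← Real.rpow_mul h0]
  norm_num

lemma aux_tendsto {n : ℕ} {F : Type*} [NormedAddCommGroup F] {f : ℕ → Euc n → F}
    (hf : ∀ k, MemLp (f k) 2 volume) :
    Tendsto (fun k => ∫ x, ‖f k x‖ ^ 2) atTop (𝓝 0) ↔
      Tendsto (fun k => eLpNorm (f k) 2 volume) atTop (𝓝 0) := by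
  have e : (fun k => ∫ x, ‖f k x‖ ^ 2) = fun k => (eLpNorm (f k) 2 volume).toReal ^ 2 :=
    funext fun k => aux_intsq (hf k)
  rw [e, ← ENNReal.tendsto_toReal_iff (fun k => (hf k).2.ne) (by simp)]
  constructor
  · intro h
    have := (Real.continuous_sqrt.tendsto 0).comp h
    simpa [Function.comp_def, Real.sqrt_sq] using this
  · intro h
    simpa using h.pow 2

lemma aux_test_memLp {n : ℕ} {Ω : Set (Euc n)} {φ : Euc n → ℝ} (h : IsTestFun Ω φ) :
    MemLp φ 2 volume := h.1.continuous.memLp_of_hasCompactSupport h.2.1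

lemma aux_grad_eq {n : ℕ} (φ : Euc n → ℝ) :
    gradient φ = fun x => (InnerProductSpace.toDual ℝ (Euc n)).symm (fderiv ℝ φ x) := rfl

lemma aux_test_cont {n : ℕ} {Ω : Set (Euc n)} {φ : Euc n → ℝ} (h : IsTestFun Ω φ) :
    Continuous (gradient φ) := by
  rw [aux_grad_eq]
  exact (LinearIsometryEquiv.continuous _).comp (h.1.continuous_fderiv (by simp))

lemma aux_test_grad {n : ℕ} {Ω : Set (Euc n)} {φ : Euc n → ℝ} (h : IsTestFun Ω φ) :
    MemLp (gradient φ) 2 volume := by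
  refine (aux_test_cont h).memLp_of_hasCompactSupport ?_
  rw [aux_grad_eq]
  exact (h.2.1.fderiv ℝ).comp_left (g := fun L => (InnerProductSpace.toDual ℝ (Euc n)).symm L) (by simp)

lemma memH10_iff {n : ℕ} {Ω : Set (Euc n)} {u : Euc n → ℝ} {Du : Euc n → Euc n} :
    MemH10 Ω u Du ↔ MemLp u 2 volume ∧ MemLp Du 2 volume ∧
      ∃ φ : ℕ → Euc n → ℝ, (∀ k, IsTestFun Ω (φ k)) ∧
        Tendsto (fun k => eLpNorm (φ k - u) 2 volume) atTop (𝓝 0) ∧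
        Tendsto (fun k => eLpNorm (gradient (φ k) - Du) 2 volume) atTop (𝓝 0) := by
  unfold MemH10
  refine and_congr_right fun hu => and_congr_right fun hDu => exists_congr fun φ =>
    and_congr_right fun hφ => ?_
  rw [← aux_tendsto (fun k => (aux_test_memLp (hφ k)).sub hu),
    ← aux_tendsto (fun k => (aux_test_grad (hφ k)).sub hDu)]
  simp

lemma MemH10.add_smul {n : ℕ} {Ω : Set (Euc n)} {u v : Euc n → ℝ} {Du Dv : Euc n → Euc n}
    (hu : MemH10 Ω u Du) (hv : MemH10 Ω v Dv) (t : ℝ) :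
    MemH10 Ω (u + t • v) (Du + t • Dv) := by
  rw [memH10_iff] at *
  obtain ⟨h1, h2, φ, h3, h4, h5⟩ := hu
  obtain ⟨g1, g2, ψ, g3, g4, g5⟩ := hv
  refine ⟨h1.add (g1.const_smul t), h2.add (g2.const_smul t), fun k => φ k + t • ψ k, ?_, ?_, ?_⟩
  · intro k
    refine ⟨(h3 k).1.add ((g3 k).1.const_smul t), (h3 k).2.1.add (g3 k).2.1.smul_left, ?_⟩
    refine (tsupport_add _ _).trans (union_subset (h3 k).2.2 ?_)
    exact (tsupport_smul_subset_right (fun _ => t) (ψ k)).trans (g3 k).2.2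
  · refine tendsto_of_tendsto_of_tendsto_of_le_of_le tendsto_const_nhds
      (g := fun _ => 0) (h := fun k => eLpNorm (φ k - u) 2 volume + ‖t‖ₑ * eLpNorm (ψ k - v) 2 volume)
      ?_ (fun _ => zero_le) fun k => ?_
    · simpa using h4.add (ENNReal.Tendsto.const_mul g4 (Or.inr (by simp)))
    · have : φ k + t • ψ k - (u + t • v) = (φ k - u) + t • (ψ k - v) := by
        ext x; simp; ring
      simp only [this]
      refine (eLpNorm_add_le ((aux_test_memLp (h3 k)).sub h1).1
        (((aux_test_memLp (g3 k)).sub g1).const_smul t).1 (by norm_num)).trans ?_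
      rw [eLpNorm_const_smul]
  · refine tendsto_of_tendsto_of_tendsto_of_le_of_le tendsto_const_nhds
      (g := fun _ => 0) (h := fun k => eLpNorm (gradient (φ k) - Du) 2 volume
        + ‖t‖ₑ * eLpNorm (gradient (ψ k) - Dv) 2 volume)
      ?_ (fun _ => zero_le) fun k => ?_
    · simpa using h5.add (ENNReal.Tendsto.const_mul g5 (Or.inr (by simp)))
    · have : gradient (φ k + t • ψ k) - (Du + t • Dv)
          = (gradient (φ k) - Du) + t • (gradient (ψ k) - Dv) := by
        have d1 := (h3 k).1.differentiable (by simp)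
        have d2 := (g3 k).1.differentiable (by simp)
        ext1 x
        have : gradient (φ k + t • ψ k) x = gradient (φ k) x + t • gradient (ψ k) x := by
          simp only [gradient]
          rw [fderiv_add (d1 x) ((d2 x).const_smul t), fderiv_const_smul (d2 x)]
          simp
        simp only [Pi.sub_apply, Pi.add_apply, Pi.smul_apply, this, smul_sub]
        abel
      simp only [this]
      refine (eLpNorm_add_le ((aux_test_grad (h3 k)).sub h2).1
        (((aux_test_grad (g3 k)).sub g2).const_smul t).1 (by norm_num)).trans ?_
      rw [eLpNorm_const_smul]

lemma MemH10.ae_seq {n : ℕ} {Ω : Set (Euc n)} {u : Euc n → ℝ} {Du : Euc n → Euc n}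
    (hu : MemH10 Ω u Du) : ∃ φ : ℕ → Euc n → ℝ, (∀ k, IsTestFun Ω (φ k)) ∧
        Tendsto (fun k => eLpNorm (φ k - u) 2 volume) atTop (𝓝 0) ∧
        Tendsto (fun k => eLpNorm (gradient (φ k) - Du) 2 volume) atTop (𝓝 0) ∧
        ∀ᵐ x, Tendsto (fun k => φ k x) atTop (𝓝 (u x)) := by
  rw [memH10_iff] at hu
  obtain ⟨h1, h2, φ, h3, h4, h5⟩ := hu
  obtain ⟨ns, hns, hae⟩ := (tendstoInMeasure_of_tendsto_eLpNorm (p := 2) (by norm_num)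
    (fun k => (aux_test_memLp (h3 k)).1) h1.1 h4).exists_seq_tendsto_ae
  exact ⟨fun k => φ (ns k), fun k => h3 _, h4.comp hns.tendsto_atTop, h5.comp hns.tendsto_atTop, hae⟩

lemma MemH10.zero_off {n : ℕ} {Ω : Set (Euc n)} {u : Euc n → ℝ} {Du : Euc n → Euc n}
    (hu : MemH10 Ω u Du) : ∀ᵐ x, x ∉ Ω → u x = 0 := by
  obtain ⟨φ, h3, -, -, h⟩ := hu.ae_seq
  filter_upwards [h] with x hx hxΩ
  refine tendsto_nhds_unique hx ?_
  have : ∀ k, φ k x = 0 := fun k => by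
    by_contra hne
    exact hxΩ ((h3 k).2.2 (subset_tsupport _ hne))
  simp [this]

lemma MemH10.comp {n : ℕ} {Ω : Set (Euc n)} {v : Euc n → ℝ} {Dv : Euc n → Euc n}
    (hv : MemH10 Ω v Dv) {η : ℝ → ℝ} (hη : ContDiff ℝ (⊤ : ℕ∞) η) (h0 : η 0 = 0)
    {C : ℝ≥0} (hC : ∀ t, ‖deriv η t‖ ≤ C) :
    MemH10 Ω (fun x => η (v x)) (fun x => deriv η (v x) • Dv x) := by
  have hdc : Continuous (deriv η) := hη.continuous_deriv (by simp)
  have hlip : LipschitzWith C η := lipschitzWith_of_nnnorm_deriv_le (hη.differentiable (by simp)) hC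
  obtain ⟨φ, h3, h4, h5, hae⟩ := hv.ae_seq
  have h1 := hv.1
  have h2 := hv.2.1
  have hsm : ∀ w : Euc n → ℝ, AEStronglyMeasurable w volume → ∀ X : Euc n → Euc n, MemLp X 2 volume →
      MemLp (fun x => deriv η (w x) • X x) 2 volume := fun w hw X hX => by
    refine hX.of_le_mul (c := C) ((hdc.comp_aestronglyMeasurable hw).smul hX.1) (ae_of_all _ fun x => ?_)
    rw [norm_smul]
    gcongr
    exact hC _
  rw [memH10_iff]
  refine ⟨?_, hsm v h1.1 Dv h2, fun k x => η (φ k x), ?_, ?_, ?_⟩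
  · refine h1.of_le_mul (c := C) (hη.continuous.comp_aestronglyMeasurable h1.1) (ae_of_all _ fun x => ?_)
    have := hlip.norm_sub_le (v x) 0
    simpa [h0] using this
  · intro k
    refine ⟨hη.comp (h3 k).1, (h3 k).2.1.comp_left h0, ?_⟩
    exact (closure_mono (fun x hx => by
      simp only [Function.mem_support] at hx ⊢
      intro h; exact hx (by simp [h, h0]))).trans (h3 k).2.2
  · refine tendsto_of_tendsto_of_tendsto_of_le_of_le tendsto_const_nhds
      (g := fun _ => 0) (h := fun k => C * eLpNorm (φ k - v) 2 volume)
      ?_ (fun _ => zero_le) fun k => ?_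
    · simpa using (ENNReal.Tendsto.const_mul h4 (Or.inr (by simp)))
    · refine (eLpNorm_le_nnreal_smul_eLpNorm_of_ae_le_mul (c := C) (g := φ k - v)
        (ae_of_all _ fun x => ?_) 2).trans le_rfl
      rw [← NNReal.coe_le_coe]
      simpa using hlip.norm_sub_le (φ k x) (v x)
  · have hg : ∀ k x, gradient (fun x => η (φ k x)) x = deriv η (φ k x) • gradient (φ k) x := by
      intro k x
      have d1 := (h3 k).1.differentiable (by simp) x
      have d2 := hη.differentiable (by simp) (φ k x)
      have := (d2.hasDerivAt.comp_hasFDerivAt x d1.hasFDerivAt).fderiv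
      simp only [gradient]
      rw [show (fun x => η (φ k x)) = η ∘ φ k from rfl, this]
      simp
    have hA : Tendsto (fun k => eLpNorm (fun x => (deriv η (φ k x) - deriv η (v x)) • Dv x) 2 volume)
        atTop (𝓝 0) := by
      rw [← aux_tendsto]
      · have : (0:ℝ) = ∫ x : Euc n, (0:ℝ) := by simp
        rw [this]
        refine tendsto_integral_of_dominated_convergence (fun x => (2 * C) ^ 2 * ‖Dv x‖ ^ 2) ?_ ?_ ?_ ?_
        · intro k
          exact ((((hdc.comp_aestronglyMeasurable (aux_test_memLp (h3 k)).1).sub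
            (hdc.comp_aestronglyMeasurable h1.1)).smul h2.1).norm.pow 2)
        · exact h2.integrable_norm_pow (by norm_num) |>.const_mul _
        · intro k
          refine ae_of_all _ fun x => ?_
          rw [Real.norm_of_nonneg (by positivity), norm_smul, mul_pow]
          gcongr
          refine (norm_sub_le _ _).trans ?_
          linarith [hC (φ k x), hC (v x)]
        · filter_upwards [hae] with x hx
          have h := ((hdc.tendsto (v x)).comp hx).sub_const (deriv η (v x))
          have := ((h.smul_const (Dv x)).norm).pow 2
          simpa using this
      · intro k
        have := (hsm _ (aux_test_memLp (h3 k)).1 Dv h2).sub (hsm _ h1.1 Dv h2)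
        refine this.congr_norm ?_ ?_
        · exact ((hdc.comp_aestronglyMeasurable (aux_test_memLp (h3 k)).1).sub
            (hdc.comp_aestronglyMeasurable h1.1)).smul h2.1
        · exact ae_of_all _ fun x => by simp [sub_smul]
    refine tendsto_of_tendsto_of_tendsto_of_le_of_le tendsto_const_nhds
      (g := fun _ => 0) (h := fun k => C * eLpNorm (gradient (φ k) - Dv) 2 volume +
        eLpNorm (fun x => (deriv η (φ k x) - deriv η (v x)) • Dv x) 2 volume)
      ?_ (fun _ => zero_le) fun k => ?_
    · simpa using (ENNReal.Tendsto.const_mul h5 (Or.inr (by simp))).add hA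
    · have e : gradient (fun x => η (φ k x)) - (fun x => deriv η (v x) • Dv x) =
          (fun x => deriv η (φ k x) • (gradient (φ k) - Dv) x) +
          (fun x => (deriv η (φ k x) - deriv η (v x)) • Dv x) := by
        ext1 x
        simp only [Pi.sub_apply, Pi.add_apply, hg, smul_sub, sub_smul]
        abel
      simp only [e]
      refine (eLpNorm_add_le (hsm _ (aux_test_memLp (h3 k)).1 _ ((aux_test_grad (h3 k)).sub h2)).1
        (((hdc.comp_aestronglyMeasurable (aux_test_memLp (h3 k)).1).sub
            (hdc.comp_aestronglyMeasurable h1.1)).smul h2.1) (by norm_num)).trans ?_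
      refine add_le_add ?_ le_rfl
      refine (eLpNorm_le_nnreal_smul_eLpNorm_of_ae_le_mul (c := C) (ae_of_all _ fun x => ?_) 2).trans le_rfl
      rw [← NNReal.coe_le_coe]
      push_cast
      rw [norm_smul]
      gcongr
      exact hC _

lemma aux_poincare_test {n : ℕ} (hn : 2 ≤ n) {Ω : Set (Euc n)} (hΩo : IsOpen Ω) (hΩb : IsBounded Ω) :
    ∃ K : ℝ≥0, ∀ φ, IsTestFun Ω φ →
      eLpNorm φ 2 volume ≤ K * eLpNorm (gradient φ) 2 volume := by
  have hnorm : ∀ φ : Euc n → ℝ, eLpNorm (gradient φ) 2 volume = eLpNorm (fderiv ℝ φ) 2 volume :=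
    fun φ => eLpNorm_congr_norm_ae (ae_of_all _ fun x => by simp [gradient])
  have hfr : Module.finrank ℝ (Euc n) = n := by simp
  rcases eq_or_lt_of_le hn with h2 | h2
  · have hfin : volume Ω ≠ ∞ := hΩb.measure_lt_top.ne
    have hfin' : volume Ω ^ (1 / (1:ℝ≥0∞).toReal - 1 / (2:ℝ≥0∞).toReal) ≠ ∞ :=
      ENNReal.rpow_ne_top_of_nonneg (by norm_num) hfin
    refine ⟨eLpNormLESNormFDerivOfLeConst ℝ (volume : Measure (Euc n)) Ω 1 2 *
      (volume Ω ^ (1 / (1:ℝ≥0∞).toReal - 1 / (2:ℝ≥0∞).toReal)).toNNReal, fun φ hφ => ?_⟩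
    have h := eLpNorm_le_eLpNorm_fderiv_of_le (volume : Measure (Euc n)) (u := φ) (s := Ω)
      (hφ.1.of_le (by exact_mod_cast le_top)) ((subset_tsupport _).trans hφ.2.2) (p := 1) (q := 2) le_rfl
      (by rw [hfr, ← h2]; norm_num) (by rw [hfr, ← h2]; norm_num) hΩb
    have h' : eLpNorm (fderiv ℝ φ) 1 volume ≤ eLpNorm (fderiv ℝ φ) 2 volume *
        volume Ω ^ (1 / (1:ℝ≥0∞).toReal - 1 / (2:ℝ≥0∞).toReal) := by
      have hsup : Function.support (fderiv ℝ φ) ⊆ Ω := (support_fderiv_subset ℝ).trans hφ.2.2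
      have r1 : eLpNorm (fderiv ℝ φ) 1 (volume.restrict Ω) = eLpNorm (fderiv ℝ φ) 1 volume :=
        eLpNorm_restrict_eq_of_support_subset (ε := Euc n →L[ℝ] ℝ) hsup
      have r2 : eLpNorm (fderiv ℝ φ) 2 (volume.restrict Ω) = eLpNorm (fderiv ℝ φ) 2 volume :=
        eLpNorm_restrict_eq_of_support_subset (ε := Euc n →L[ℝ] ℝ) hsup
      rw [← r1, ← r2]
      have := eLpNorm_le_eLpNorm_mul_rpow_measure_univ (μ := volume.restrict Ω) (p := 1) (q := 2)
        (by norm_num) ((hφ.1.continuous_fderiv (by simp)).aestronglyMeasurable)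
      simpa using this
    rw [hnorm]
    push_cast
    rw [ENNReal.coe_toNNReal hfin', mul_assoc, mul_comm (volume Ω ^ _)]
    refine h.trans ?_
    gcongr
    exact h'
  · refine ⟨eLpNormLESNormFDerivOfLeConst ℝ (volume : Measure (Euc n)) Ω 2 2, fun φ hφ => ?_⟩
    rw [hnorm]
    exact eLpNorm_le_eLpNorm_fderiv (volume : Measure (Euc n)) (u := φ) (s := Ω)
      (hφ.1.of_le (by exact_mod_cast le_top)) ((subset_tsupport _).trans hφ.2.2) (p := 2) (by norm_num)
      (by rw [hfr]; exact_mod_cast h2) hΩb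

lemma aux_poincare {n : ℕ} (hn : 2 ≤ n) {Ω : Set (Euc n)} (hΩo : IsOpen Ω) (hΩb : IsBounded Ω) :
    ∃ K : ℝ, 0 < K ∧ ∀ u Du, MemH10 Ω u Du → ∫ x, u x ^ 2 ≤ K * ∫ x, ‖Du x‖ ^ 2 := by
  obtain ⟨K, hK⟩ := aux_poincare_test hn hΩo hΩb
  refine ⟨K ^ 2 + 1, by positivity, fun u Du hu => ?_⟩
  have key : eLpNorm u 2 volume ≤ K * eLpNorm Du 2 volume := by
    obtain ⟨φ, h3, h4, h5, -⟩ := hu.ae_seq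
    have ht : Tendsto (fun k => eLpNorm (φ k - u) 2 volume + K * (eLpNorm (gradient (φ k) - Du) 2 volume
        + eLpNorm Du 2 volume)) atTop (𝓝 (0 + K * (0 + eLpNorm Du 2 volume))) :=
      h4.add (ENNReal.Tendsto.const_mul (h5.add tendsto_const_nhds) (Or.inr (by simp)))
    simp only [zero_add] at ht
    refine ge_of_tendsto ht (Eventually.of_forall fun k => ?_)
    have e1 : eLpNorm u 2 volume ≤ eLpNorm (φ k - u) 2 volume + eLpNorm (φ k) 2 volume := by
      have := eLpNorm_sub_le (μ := volume) (p := 2) (aux_test_memLp (h3 k)).1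
        ((aux_test_memLp (h3 k)).sub hu.1).1 (by norm_num)
      rw [sub_sub_cancel, add_comm] at this
      exact this
    have e2 : eLpNorm (gradient (φ k)) 2 volume ≤ eLpNorm (gradient (φ k) - Du) 2 volume
        + eLpNorm Du 2 volume := by
      have := eLpNorm_add_le (μ := volume) (p := 2) ((aux_test_grad (h3 k)).sub hu.2.1).1
        hu.2.1.1 (by norm_num)
      rwa [sub_add_cancel] at this
    refine e1.trans ?_
    gcongr
    refine (hK _ (h3 k)).trans ?_
    gcongr
  have a1 := aux_intsq hu.1
  have a2 := aux_intsq hu.2.1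
  simp only [Real.norm_eq_abs, sq_abs] at a1
  rw [a1, a2]
  have := ENNReal.toReal_mono (ENNReal.mul_ne_top (by simp) hu.2.1.2.ne) key
  rw [ENNReal.toReal_mul, ENNReal.coe_toReal] at this
  have h0 : 0 ≤ (eLpNorm u 2 volume).toReal := ENNReal.toReal_nonneg
  nlinarith [sq_nonneg (eLpNorm Du 2 volume).toReal]

lemma aux_quad {a b : ℝ} (h : ∀ t : ℝ, 0 ≤ a * t ^ 2 + b * t) : b = 0 := by
  have := discrim_le_zero (a := a) (b := b) (c := 0) (fun t => by nlinarith [h t])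
  simp only [discrim] at this
  nlinarith [sq_nonneg b]

lemma aux_inner_int {n : ℕ} {F : Type*} [NormedAddCommGroup F] [InnerProductSpace ℝ F]
    {f g : Euc n → F} (hf : MemLp f 2 volume) (hg : MemLp g 2 volume) :
    Integrable (fun x => inner ℝ (f x) (g x)) volume := by
  refine ((hf.integrable_norm_pow (p := 2) (by norm_num)).add
    (hg.integrable_norm_pow (p := 2) (by norm_num))).mono (hf.1.inner hg.1) (ae_of_all _ fun x => ?_)
  refine (norm_inner_le_norm _ _).trans ?_
  simp only [Pi.add_apply, Real.norm_eq_abs]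
  rw [abs_of_nonneg (by positivity)]
  nlinarith [sq_nonneg (‖f x‖ - ‖g x‖), sq_nonneg (‖f x‖), sq_nonneg ‖g x‖]

lemma aux_expand {n : ℕ} {F : Type*} [NormedAddCommGroup F] [InnerProductSpace ℝ F]
    {f g : Euc n → F} (hf : MemLp f 2 volume) (hg : MemLp g 2 volume) (t : ℝ) :
    ∫ x, ‖(f + t • g) x‖ ^ 2 = (∫ x, ‖f x‖ ^ 2) + 2 * t * (∫ x, inner ℝ (f x) (g x))
      + t ^ 2 * ∫ x, ‖g x‖ ^ 2 := by
  have i1 := hf.integrable_norm_pow (p := 2) (by norm_num)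
  have i2 := hg.integrable_norm_pow (p := 2) (by norm_num)
  have i3 := aux_inner_int hf hg
  rw [← integral_const_mul, ← integral_const_mul, ← integral_add i1 (i3.const_mul _),
    ← integral_add (f := fun x => ‖f x‖ ^ 2 + 2 * t * inner ℝ (f x) (g x))
      (i1.add (i3.const_mul _)) (i2.const_mul _)]
  refine integral_congr_ae (ae_of_all _ fun x => ?_)
  simp only [Pi.add_apply, Pi.smul_apply, norm_add_sq_real, inner_smul_right, norm_smul, mul_pow,
    Real.norm_eq_abs, sq_abs]
  ring

lemma MemH10.integrable {n : ℕ} {Ω : Set (Euc n)} (hΩo : IsOpen Ω) (hΩb : IsBounded Ω)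
    {u : Euc n → ℝ} {Du : Euc n → Euc n} (hu : MemH10 Ω u Du) : Integrable u volume := by
  have hfin : volume Ω ≠ ∞ := hΩb.measure_lt_top.ne
  have i1 : Integrable (fun x => u x ^ 2) volume := hu.1.integrable_sq
  have i2 : Integrable (Ω.indicator (fun _ => (1:ℝ))) volume :=
    (integrable_indicator_iff hΩo.measurableSet).2 (integrableOn_const hfin)
  refine (i1.add i2).mono hu.1.1 ?_
  filter_upwards [hu.zero_off] with x hx
  simp only [Pi.add_apply, Real.norm_eq_abs]
  by_cases h : x ∈ Ω
  · simp only [h, indicator_of_mem]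
    rw [abs_of_nonneg (a := u x ^ 2 + 1) (by positivity), ← sq_abs]
    nlinarith [sq_nonneg (|u x| - 1), abs_nonneg (u x)]
  · simp [h, hx h]

lemma aux_tor_bdd {n : ℕ} (hn : 2 ≤ n) {Ω : Set (Euc n)} (hΩo : IsOpen Ω) (hΩb : IsBounded Ω) :
    BddBelow {r | ∃ w Dw, MemH10 Ω w Dw ∧ r = ∫ x, ((1 / 2) * ‖Dw x‖ ^ 2 - w x)} := by
  obtain ⟨K, hK0, hK⟩ := aux_poincare hn hΩo hΩb
  have hfin : volume Ω ≠ ∞ := hΩb.measure_lt_top.ne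
  refine ⟨-(K * volume.real Ω), ?_⟩
  rintro r ⟨w, Dw, hw, rfl⟩
  have i0 : Integrable (fun x => (1 / 2) * ‖Dw x‖ ^ 2) volume :=
    (hw.2.1.integrable_norm_pow (p := 2) (by norm_num)).const_mul _
  have iw := hw.integrable hΩo hΩb
  have i1 : Integrable (fun x => w x ^ 2) volume := hw.1.integrable_sq
  have i2 : Integrable (Ω.indicator (fun _ => K)) volume :=
    (integrable_indicator_iff hΩo.measurableSet).2 (integrableOn_const hfin)
  have hle : ∫ x, w x ≤ ∫ x, ((1 / (2 * K)) * w x ^ 2 + Ω.indicator (fun _ => K) x) := by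
    refine integral_mono_ae iw ((i1.const_mul _).add i2) ?_
    filter_upwards [hw.zero_off] with x hx
    by_cases h : x ∈ Ω
    · simp only [h, indicator_of_mem]
      have : 1 / (2 * K) * w x ^ 2 + K - w x = ((w x - K) ^ 2 + K ^ 2) / (2 * K) := by
        field_simp; ring
      have h2 : 0 ≤ ((w x - K) ^ 2 + K ^ 2) / (2 * K) := by positivity
      linarith
    · simp [h, hx h]
  rw [integral_add (i1.const_mul _) i2, integral_const_mul, integral_indicator hΩo.measurableSet,
    setIntegral_const, smul_eq_mul] at hle
  rw [integral_sub i0 iw, integral_const_mul]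
  have h3 : 1 / (2 * K) * ∫ x, w x ^ 2 ≤ 1 / 2 * ∫ x, ‖Dw x‖ ^ 2 := by
    have := mul_le_mul_of_nonneg_left (hK w Dw hw) (show 0 ≤ 1 / (2 * K) by positivity)
    refine this.trans (le_of_eq ?_)
    field_simp
  linarith

lemma aux_torsion_EL {n : ℕ} (hn : 2 ≤ n) {Ω : Set (Euc n)} (hΩo : IsOpen Ω) (hΩb : IsBounded Ω)
    {w : Euc n → ℝ} {Dw : Euc n → Euc n} (hw : MemH10 Ω w Dw)
    (hmin : (∫ x, ((1 / 2) * ‖Dw x‖ ^ 2 - w x)) = tor Ω)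
    {φ : Euc n → ℝ} {Dφ : Euc n → Euc n} (hφ : MemH10 Ω φ Dφ) :
    ∫ x, inner ℝ (Dw x) (Dφ x) = ∫ x, φ x := by
  have hE : ∀ v Dv, MemH10 Ω v Dv → ∫ x, ((1 / 2) * ‖Dv x‖ ^ 2 - v x) =
      (1 / 2) * (∫ x, ‖Dv x‖ ^ 2) - ∫ x, v x := fun v Dv hv => by
    rw [integral_sub ((hv.2.1.integrable_norm_pow (p := 2) (by norm_num)).const_mul _)
      (hv.integrable hΩo hΩb), integral_const_mul]
  have := aux_quad (a := (1 / 2) * ∫ x, ‖Dφ x‖ ^ 2)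
    (b := (∫ x, inner ℝ (Dw x) (Dφ x)) - ∫ x, φ x) (fun t => ?_)
  · linarith
  have h := hw.add_smul hφ t
  have h1 : tor Ω ≤ _ := csInf_le (aux_tor_bdd hn hΩo hΩb) ⟨_, _, h, rfl⟩
  rw [hE _ _ h, aux_expand hw.2.1 hφ.2.1, ← hmin, hE _ _ hw] at h1
  have h2 : ∫ x, (w + t • φ) x = (∫ x, w x) + t * ∫ x, φ x := by
    simp only [Pi.add_apply, Pi.smul_apply, smul_eq_mul]
    rw [integral_add (hw.integrable hΩo hΩb) ((hφ.integrable hΩo hΩb).const_mul t), integral_const_mul]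
  rw [h2] at h1
  linarith

lemma aux_lam1_nonneg {n : ℕ} (Ω : Set (Euc n)) : 0 ≤ lam1 Ω := by
  refine Real.sInf_nonneg ?_
  rintro r ⟨u, Du, -, -, rfl⟩
  exact div_nonneg (integral_nonneg fun x => by positivity) (integral_nonneg fun x => by positivity)

lemma aux_rayleigh {n : ℕ} {Ω : Set (Euc n)} {u : Euc n → ℝ} {Du : Euc n → Euc n}
    (hu : MemH10 Ω u Du) : lam1 Ω * ∫ x, u x ^ 2 ≤ ∫ x, ‖Du x‖ ^ 2 := by
  have h0 : 0 ≤ ∫ x, u x ^ 2 := integral_nonneg fun x => by positivity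
  rcases h0.eq_or_lt with h | h
  · rw [← h, mul_zero]
    exact integral_nonneg fun x => by positivity
  · rw [← le_div_iff₀ h]
    refine csInf_le ⟨0, ?_⟩ ⟨u, Du, hu, h.ne', rfl⟩
    rintro r ⟨u, Du, -, -, rfl⟩
    exact div_nonneg (integral_nonneg fun x => by positivity) (integral_nonneg fun x => by positivity)

lemma aux_eigen_EL {n : ℕ} {Ω : Set (Euc n)}
    {u : Euc n → ℝ} {Du : Euc n → Euc n} (hu : MemH10 Ω u Du)
    (h1 : (∫ x, u x ^ 2) = 1) (hmin : (∫ x, ‖Du x‖ ^ 2) = lam1 Ω)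
    {φ : Euc n → ℝ} {Dφ : Euc n → Euc n} (hφ : MemH10 Ω φ Dφ) :
    ∫ x, inner ℝ (Du x) (Dφ x) = lam1 Ω * ∫ x, u x * φ x := by
  have := aux_quad (a := (∫ x, ‖Dφ x‖ ^ 2) - lam1 Ω * ∫ x, φ x ^ 2)
    (b := 2 * ((∫ x, inner ℝ (Du x) (Dφ x)) - lam1 Ω * ∫ x, u x * φ x)) (fun t => ?_)
  · linarith
  have h := aux_rayleigh (hu.add_smul hφ t)
  rw [aux_expand hu.2.1 hφ.2.1, hmin] at h
  have e := aux_expand hu.1 hφ.1 t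
  simp only [Real.norm_eq_abs, sq_abs, h1] at e
  have e' : ∫ x, inner ℝ (u x) (φ x) = ∫ x, u x * φ x :=
    integral_congr_ae (ae_of_all _ fun x => by simp [mul_comm])
  rw [e, e'] at h
  linarith

lemma aux_deriv_bdd : ∃ C : ℝ≥0, ∀ t, ‖deriv Real.smoothTransition t‖ ≤ C := by
  have hc : Continuous (deriv Real.smoothTransition) :=
    (Real.smoothTransition.contDiff (n := 1)).continuous_deriv (by simp)
  obtain ⟨C, hC⟩ := (isCompact_Icc (a := (0:ℝ)) (b := 1)).exists_bound_of_continuousOn hc.continuousOn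
  refine ⟨C.toNNReal, fun t => ?_⟩
  have hle : C ≤ C.toNNReal := Real.le_coe_toNNReal C
  by_cases ht : t ∈ Icc (0:ℝ) 1
  · exact (hC t ht).trans hle
  · have : deriv Real.smoothTransition t = 0 := by
      rw [mem_Icc, not_and_or, not_le, not_le] at ht
      rcases ht with ht | ht
      · have : Real.smoothTransition =ᶠ[𝓝 t] fun _ => 0 := by
          filter_upwards [Iio_mem_nhds ht] with s hs
          exact Real.smoothTransition.zero_of_nonpos (le_of_lt hs)
        rw [this.deriv_eq]; simp
      · have : Real.smoothTransition =ᶠ[𝓝 t] fun _ => 1 := by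
          filter_upwards [Ioi_mem_nhds ht] with s hs
          exact Real.smoothTransition.one_of_one_le (le_of_lt hs)
        rw [this.deriv_eq]; simp
    rw [this]; simp

/-- **The torsion function dominates the first eigenfunction.** If `u` is a normalized
first eigenfunction of a nonempty bounded open `Ω ⊆ ℝⁿ` with `u ≤ M` a.e., and `w` is
the torsion function of `Ω`, then `u ≤ λ₁(Ω)·M·w` a.e. -/
theorem torsion_dominates_eigenfunction (n : ℕ) (hn : 2 ≤ n)
    (Ω : Set (Euc n)) (hΩo : IsOpen Ω) (hΩne : Ω.Nonempty) (hΩb : IsBounded Ω)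
    (u : Euc n → ℝ) (hu : IsEigenfun Ω u)
    (M : ℝ) (hM : 0 < M) (hub : ∀ᵐ x ∂volume, u x ≤ M)
    (w : Euc n → ℝ) (hw : IsTorsionFun Ω w) :
    ∀ᵐ x ∂volume, u x ≤ lam1 Ω * M * w x := by
  obtain ⟨hu0, -, hu1, Du, huH, hul⟩ := hu
  obtain ⟨-, Dw, hwH, hwt⟩ := hw
  obtain ⟨K, hK0, hK⟩ := aux_poincare hn hΩo hΩb
  obtain ⟨C, hC⟩ := aux_deriv_bdd
  set c := lam1 Ω * M with hc
  have hl := aux_lam1_nonneg Ω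
  have hv := huH.add_smul hwH (-c)
  set v := u + (-c) • w with hvdef
  set Dv := Du + (-c) • Dw with hDvdef
  have hη := hv.comp Real.smoothTransition.contDiff Real.smoothTransition.zero hC
  set Dψ := fun x => deriv Real.smoothTransition (v x) • Dv x with hDψ
  set ψ := fun x => Real.smoothTransition (v x) with hψ
  have e1 := aux_eigen_EL huH hu1 hul hη
  have e2 := aux_torsion_EL hn hΩo hΩb hwH hwt hη
  have iψ := hη.integrable hΩo hΩb
  have iuψ : Integrable (fun x => u x * ψ x) volume := huH.1.integrable_mul hη.1
  have hd : ∀ t, 0 ≤ deriv Real.smoothTransition t := fun t => Real.smoothTransition.monotone.deriv_nonneg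
  have e3 : ∫ x, deriv Real.smoothTransition (v x) * ‖Dv x‖ ^ 2 =
      lam1 Ω * (∫ x, u x * ψ x) - c * ∫ x, ψ x := by
    rw [← e1, ← e2, ← integral_const_mul, ← integral_sub (aux_inner_int huH.2.1 hη.2.1)
      ((aux_inner_int hwH.2.1 hη.2.1).const_mul c)]
    refine integral_congr_ae (ae_of_all _ fun x => ?_)
    have : inner ℝ (Dv x) (Dψ x) = inner ℝ (Du x) (Dψ x) - c * inner ℝ (Dw x) (Dψ x) := by
      simp only [hDvdef, Pi.add_apply, Pi.smul_apply, inner_add_left, inner_smul_left]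
      simp; ring
    simp only [← this]
    simp only [hDψ, inner_smul_right, real_inner_self_eq_norm_sq]
  have e4 : ∫ x, u x * ψ x ≤ M * ∫ x, ψ x := by
    rw [← integral_const_mul]
    refine integral_mono_ae iuψ (iψ.const_mul M) ?_
    filter_upwards [hub] with x hx
    exact mul_le_mul_of_nonneg_right hx (Real.smoothTransition.nonneg _)
  have e5 : ∫ x, deriv Real.smoothTransition (v x) * ‖Dv x‖ ^ 2 ≤ 0 := by
    rw [e3, hc]
    nlinarith [mul_le_mul_of_nonneg_left e4 hl]
  have e6 : ∫ x, ‖Dψ x‖ ^ 2 ≤ 0 := by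
    have i1 : Integrable (fun x => deriv Real.smoothTransition (v x) * ‖Dv x‖ ^ 2) volume := by
      have := aux_inner_int hv.2.1 hη.2.1
      refine this.congr (ae_of_all _ fun x => ?_)
      simp only [hDψ, inner_smul_right, real_inner_self_eq_norm_sq]
    have : ∫ x, ‖Dψ x‖ ^ 2 ≤ ∫ x, C * (deriv Real.smoothTransition (v x) * ‖Dv x‖ ^ 2) := by
      refine integral_mono (hη.2.1.integrable_norm_pow (p := 2) (by norm_num)) (i1.const_mul _) fun x => ?_
      have h1 := hC (v x)
      simp only [hDψ, norm_smul, mul_pow]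
      rw [Real.norm_of_nonneg (hd _)] at h1 ⊢
      rw [← mul_assoc, sq (deriv _ _)]
      gcongr
      exact hd _
    rw [integral_const_mul] at this
    exact this.trans (mul_nonpos_of_nonneg_of_nonpos C.2 e5)
  have e7 : ∫ x, ψ x ^ 2 = 0 := by
    refine le_antisymm ?_ (integral_nonneg fun x => by positivity)
    exact (hK _ _ hη).trans (mul_nonpos_of_nonneg_of_nonpos hK0.le e6)
  rw [integral_eq_zero_iff_of_nonneg (fun x => by positivity) hη.1.integrable_sq] at e7
  filter_upwards [e7] with x hx
  by_contra hlt
  push Not at hlt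
  have hp : 0 < v x := by simp [hvdef]; linarith
  have := Real.smoothTransition.pos_of_pos hp
  simp only [Pi.zero_apply, hψ] at hx
  exact absurd hx (by positivity)
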